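/- Let 0 < α ≤ 1 and let A be a real n×n Metzler matrix. Then for every t ≥ 0 the matrix E_{α,α}(A t^α) = Σ_{ℓ=0}^∞ t^{αℓ} A^ℓ / Γ(αℓ + α) is entrywise nonnegative; consequently Φ_α(t) := t^{α−1} E_{α,α}(A t^α) is entrywise nonnegative for every t > 0. -/

import Mathlib

/-- A real `n × n` matrix is *Metzler* if all of its off-diagonal entries are nonnegative. -/
def Matrix.IsMetzler {n : ℕ} (A : Matrix (Fin n) (Fin n) ℝ) : Prop :=
  ∀ i j : Fin n, i ≠ j → 0 ≤ A i j

open Filter Topology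

/-- Coefficient of `z ^ m` in `(1 - z) ^ (-s)`. -/
noncomputable def mlRf (m : ℕ) (s : ℝ) : ℝ := ∏ k ∈ Finset.range m, (s + k) / (k + 1)

lemma mlRf_succ (m : ℕ) (s : ℝ) : mlRf (m + 1) s = mlRf m s * ((s + m) / (m + 1)) := by
  rw [mlRf, mlRf, Finset.prod_range_succ]

lemma mlRf_zero (s : ℝ) : mlRf 0 s = 1 := by simp [mlRf]

lemma mlRf_eq_choose (m : ℕ) (s : ℝ) : mlRf m s = (-1) ^ m * Ring.choose (-s) m := by
  induction m with
  | zero => simp [mlRf_zero]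
  | succ m ih =>
    rw [mlRf_succ, ih, Ring.choose_eq_smul, Ring.choose_eq_smul, descPochhammer_succ_right]
    simp only [Polynomial.smeval_mul, Polynomial.smeval_sub,
      Polynomial.smeval_X, Polynomial.smeval_natCast, pow_one, pow_zero, nsmul_eq_mul, mul_one, smul_eq_mul, Nat.factorial_succ, Nat.cast_mul,
      Nat.cast_succ]
    have : (m.factorial : ℝ) ≠ 0 := by positivity
    field_simp
    ring

lemma mlRf_vandermonde (m : ℕ) (a b : ℝ) :
    mlRf m (a + b) = ∑ p ∈ Finset.HasAntidiagonal.antidiagonal m, mlRf p.1 a * mlRf p.2 b := by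
  rw [mlRf_eq_choose, neg_add, Ring.add_choose_eq m (Commute.all _ _), Finset.mul_sum]
  refine Finset.sum_congr rfl fun p hp => ?_
  rw [mlRf_eq_choose, mlRf_eq_choose, ← Finset.HasAntidiagonal.mem_antidiagonal.1 hp, pow_add]
  ring

lemma mlRf_nonneg (m : ℕ) {s : ℝ} (hs : 0 ≤ s) : 0 ≤ mlRf m s :=
  Finset.prod_nonneg fun k _ => by positivity

lemma mlRf_le (m : ℕ) {s : ℝ} (hs : 0 ≤ s) : mlRf m s ≤ (1 + s) ^ m := by
  induction m with
  | zero => simp [mlRf_zero]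
  | succ m ih =>
    rw [mlRf_succ, pow_succ]
    refine mul_le_mul ih ?_ (by positivity) (by positivity)
    rw [div_le_iff₀ (by positivity)]
    nlinarith [mul_nonneg hs (Nat.cast_nonneg (α := ℝ) m)]

lemma mlRf_neg_nonpos (m : ℕ) {a : ℝ} (h0 : 0 < a) (h1 : a ≤ 1) : mlRf (m + 1) (-a) ≤ 0 := by
  induction m with
  | zero => simp [mlRf_succ, mlRf_zero, h0.le]
  | succ m ih =>
    rw [mlRf_succ]
    refine mul_nonpos_of_nonpos_of_nonneg ih (div_nonneg ?_ (by positivity))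
    push_cast
    nlinarith [Nat.cast_nonneg (α := ℝ) m]

lemma mlRf_succ_zero (m : ℕ) : mlRf (m + 1) 0 = 0 := by
  rw [mlRf, Finset.prod_range_succ']; simp

lemma inv_gammaSeq (m : ℕ) (hm : 0 < m) (s : ℝ) :
    (Real.GammaSeq s m)⁻¹ = (m + 1) * mlRf (m + 1) s * (m : ℝ) ^ (-s) := by
  have h : ∀ m : ℕ, mlRf m s = (∏ j ∈ Finset.range m, (s + j)) / m.factorial := by
    intro m
    induction m with
    | zero => simp [mlRf_zero]
    | succ m ih =>
      rw [mlRf_succ, ih, Finset.prod_range_succ, Nat.factorial_succ]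
      push_cast
      rw [div_mul_div_comm, mul_comm (m.factorial : ℝ)]
  rw [h, Real.GammaSeq, inv_div, Real.rpow_neg (by positivity), Nat.factorial_succ]
  have : (m.factorial : ℝ) ≠ 0 := by positivity
  have : (m : ℝ) ^ s ≠ 0 := by positivity
  push_cast
  field_simp

lemma mlRf_bound (L : ℕ) (hL : 0 < L) {s : ℝ} (hs : 0 ≤ s) (m : ℕ) (hm : L ≤ m) :
    (m + 1) * mlRf (m + 1) s ≤ (1 + s) ^ (L + 1) * ((m : ℝ) / L) ^ s * (L + 1) := by
  induction m, hm using Nat.le_induction with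
  | base =>
    rw [div_self (by positivity), Real.one_rpow, mul_one, mul_comm]
    exact mul_le_mul_of_nonneg_right (mlRf_le _ hs) (by positivity)
  | succ m hm ih =>
    have hm0 : 0 < m := by omega
    have hm0' : (0 : ℝ) < m := by positivity
    have key : 1 + s / (m + 1) ≤ (((m : ℝ) + 1) / m) ^ s := by
      rw [Real.rpow_def_of_pos (by positivity)]
      have h1 := Real.add_one_le_exp (s / (m + 1))
      have h2 : s / (m + 1) ≤ Real.log (((m : ℝ) + 1) / m) * s := by
        have := Real.log_le_sub_one_of_pos (x := (m : ℝ) / (m + 1)) (by positivity)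
        rw [← inv_div, Real.log_inv] at *
        have e : (m : ℝ) / (m + 1) - 1 = - (1 / (m + 1)) := by field_simp; ring
        rw [inv_div, e] at this
        rw [inv_div]
        calc s / (m + 1) = (1 / (m + 1)) * s := by ring
          _ ≤ _ := by
            apply mul_le_mul_of_nonneg_right _ hs
            linarith
      linarith [Real.exp_le_exp.2 h2]
    have e : ((m + 1 : ℕ) + 1 : ℝ) * mlRf (m + 1 + 1) s
        = ((m + 1) * mlRf (m + 1) s) * (1 + s / (m + 1)) := by
      rw [mlRf_succ (m + 1)]; push_cast; field_simp; ring
    rw [e]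
    have e2 : (((m + 1 : ℕ) : ℝ) / L) ^ s = ((m : ℝ) / L) ^ s * (((m : ℝ) + 1) / m) ^ s := by
      rw [← Real.mul_rpow (by positivity) (by positivity)]
      congr 1; push_cast; field_simp
    rw [e2]
    calc _ ≤ ((1 + s) ^ (L + 1) * ((m : ℝ) / L) ^ s * (L + 1)) * (((m : ℝ) + 1) / m) ^ s :=
          mul_le_mul ih key (by positivity) (by positivity)
      _ = _ := by ring

lemma ml_summable (k : ℕ) {r : ℝ} (h0 : 0 ≤ r) (h1 : r < 1) :
    Summable fun l : ℕ => ((l : ℝ) + 2) ^ k * r ^ l := by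
  rcases h0.eq_or_lt with rfl | h0
  · refine summable_of_ne_finset_zero (s := {0}) fun b hb => ?_
    simp at hb
    simp [hb]
  have := (summable_nat_add_iff 2).2
    (summable_pow_mul_geometric_of_norm_lt_one k (r := r) (by rwa [Real.norm_of_nonneg h0.le]))
  refine (this.mul_right (r ^ 2)⁻¹).congr fun l => ?_
  push_cast
  rw [pow_add]; field_simp

section cone
variable {𝔸 : Type*} [NormedRing 𝔸] [NormedAlgebra ℝ 𝔸] [CompleteSpace 𝔸] [NormOneClass 𝔸]

lemma ml_term_summable (m : ℕ) {x α : ℝ} (hx : 0 ≤ x) (h0 : 0 < α) (h1 : α ≤ 1) (A : 𝔸)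
    (hA : x * ‖A‖ < 1) :
    Summable fun l : ℕ => (x ^ l * mlRf m (α * (l + 1))) • A ^ l := by
  refine Summable.of_norm_bounded (ml_summable m (r := x * ‖A‖) (by positivity) hA) fun l => ?_
  have hs : 0 ≤ α * ((l : ℝ) + 1) := by positivity
  rw [norm_smul, Real.norm_of_nonneg (mul_nonneg (by positivity) (mlRf_nonneg _ hs)), mul_pow]
  have e1 : mlRf m (α * (l + 1)) ≤ ((l : ℝ) + 2) ^ m := by
    refine (mlRf_le m hs).trans (pow_le_pow_left₀ (by positivity) ?_ _)
    nlinarith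
  calc _ ≤ (x ^ l * ((l : ℝ) + 2) ^ m) * ‖A‖ ^ l := by
        gcongr
        exact norm_pow_le A l
    _ = _ := by ring

noncomputable def mlD (x α : ℝ) (A : 𝔸) (m : ℕ) : 𝔸 :=
  ∑' l : ℕ, (x ^ l * mlRf m (α * (l + 1))) • A ^ l

lemma mlD_rec (m : ℕ) {x α : ℝ} (hx : 0 ≤ x) (h0 : 0 < α) (h1 : α ≤ 1) (A : 𝔸)
    (hA : x * ‖A‖ < 1) :
    ∑ p ∈ Finset.HasAntidiagonal.antidiagonal m, mlRf p.1 (-α) • mlD x α A p.2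
      = mlRf m 0 • 1 + (x • A) * mlD x α A m := by
  have hsum := fun j => ml_term_summable j hx h0 h1 A hA
  have e1 : ∑ p ∈ Finset.HasAntidiagonal.antidiagonal m, mlRf p.1 (-α) • mlD x α A p.2
      = ∑' l : ℕ, (x ^ l * mlRf m (α * l)) • A ^ l := by
    simp only [mlD]
    have g1 : ∀ p : ℕ × ℕ, mlRf p.1 (-α) • ∑' l : ℕ, (x ^ l * mlRf p.2 (α * (l + 1))) • A ^ l
        = ∑' l : ℕ, mlRf p.1 (-α) • (x ^ l * mlRf p.2 (α * (l + 1))) • A ^ l :=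
      fun p => ((hsum p.2).tsum_const_smul (mlRf p.1 (-α))).symm
    have g2 : ∀ p ∈ Finset.HasAntidiagonal.antidiagonal m, Summable fun l : ℕ =>
        mlRf p.1 (-α) • (x ^ l * mlRf p.2 (α * (l + 1))) • A ^ l :=
      fun p _ => (hsum p.2).const_smul (mlRf p.1 (-α))
    rw [Finset.sum_congr rfl fun p _ => g1 p, ← Summable.tsum_finsetSum g2]
    refine tsum_congr fun l => ?_
    have : α * (l : ℝ) = -α + α * (l + 1) := by ring
    rw [this, mlRf_vandermonde, Finset.mul_sum, Finset.sum_smul]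
    refine Finset.sum_congr rfl fun p _ => ?_
    rw [smul_smul]; congr 1; ring
  have e2 : ∀ l : ℕ, (x ^ (l + 1) * mlRf m (α * (l + 1 : ℕ))) • A ^ (l + 1)
      = (x • A) * ((x ^ l * mlRf m (α * (l + 1))) • A ^ l) := by
    intro l
    rw [smul_mul_smul_comm, pow_succ' A]; push_cast; congr 1; ring
  rw [e1, Summable.tsum_eq_zero_add]
  · simp only [e2]
    rw [(hsum m).tsum_mul_left]
    simp [mlD]
  · rw [← summable_nat_add_iff 1]
    simp only [e2]
    exact (hsum m).mul_left _

lemma ml_resolvent (N : Subsemiring 𝔸) (hN : IsClosed (N : Set 𝔸))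
    (hsm : ∀ r : ℝ, 0 ≤ r → ∀ a ∈ N, r • a ∈ N) (A : 𝔸) (c : ℝ) (hc : 0 ≤ c)
    (hB : A + c • 1 ∈ N) (x : ℝ) (hx : 0 ≤ x) (hxB : x * ‖A + c • (1 : 𝔸)‖ < 1) :
    ∃ V ∈ N, V * (1 - x • A) = 1 := by
  set B := A + c • (1 : 𝔸) with hBd
  have hp : 0 < 1 + x * c := by positivity
  set y := x / (1 + x * c) with hy
  have hy0 : 0 ≤ y := by positivity
  have hyx : y ≤ x := div_le_self hx (by nlinarith [mul_nonneg hx hc])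
  have hn : ‖y • B‖ < 1 := by
    rw [norm_smul, Real.norm_of_nonneg hy0]
    exact (mul_le_mul_of_nonneg_right hyx (norm_nonneg _)).trans_lt hxB
  refine ⟨(1 + x * c)⁻¹ • ∑' i : ℕ, (y • B) ^ i,
    hsm _ (by positivity) _ (tsum_mem hN fun i => pow_mem (hsm _ hy0 _ hB) i), ?_⟩
  have e : 1 - x • A = (1 + x * c) • (1 - y • B) := by
    rw [smul_sub, smul_smul, hy, mul_div_cancel₀ _ hp.ne', hBd, smul_add, smul_smul, add_smul,
      one_smul]
    abel
  rw [e, smul_mul_smul_comm, inv_mul_cancel₀ hp.ne', one_smul, geom_series_mul_neg _ hn]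

lemma mlD_mem (N : Subsemiring 𝔸) (hN : IsClosed (N : Set 𝔸))
    (hsm : ∀ r : ℝ, 0 ≤ r → ∀ a ∈ N, r • a ∈ N) (A : 𝔸) (c : ℝ) (hc : 0 ≤ c)
    (hB : A + c • 1 ∈ N) (x : ℝ) (hx : 0 ≤ x) (hxB : x * ‖A + c • (1 : 𝔸)‖ < 1)
    {α : ℝ} (h0 : 0 < α) (h1 : α ≤ 1) (hA : x * ‖A‖ < 1) (m : ℕ) : mlD x α A m ∈ N := by
  obtain ⟨V, hV, hV1⟩ := ml_resolvent N hN hsm A c hc hB x hx hxB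
  have hVD : ∀ m, mlD x α A m = V * (mlD x α A m - (x • A) * mlD x α A m) := by
    intro m
    have : mlD x α A m - (x • A) * mlD x α A m = (1 - x • A) * mlD x α A m := by
      rw [sub_mul, one_mul]
    rw [this, ← mul_assoc, hV1, one_mul]
  induction m using Nat.strong_induction_on with
  | _ m ih =>
    rw [hVD]
    refine mul_mem hV ?_
    have hr := mlD_rec m hx h0 h1 A hA
    cases m with
    | zero =>
      simp only [Finset.Nat.antidiagonal_zero, Finset.sum_singleton, mlRf_zero, one_smul] at hr
      have : mlD x α A 0 - (x • A) * mlD x α A 0 = 1 := by rw [sub_eq_iff_eq_add]; exact hr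
      rw [this]; exact one_mem N
    | succ m =>
      rw [Finset.Nat.sum_antidiagonal_succ, mlRf_zero, one_smul, mlRf_succ_zero, zero_smul,
        zero_add] at hr
      rw [← hr, sub_add_cancel_left, ← Finset.sum_neg_distrib]
      refine sum_mem fun p hp => ?_
      rw [← neg_smul]
      have := Finset.HasAntidiagonal.mem_antidiagonal.1 hp
      exact hsm _ (neg_nonneg.2 (mlRf_neg_nonpos _ h0 h1)) _ (ih _ (by omega))

lemma ml_cone (N : Subsemiring 𝔸) (hN : IsClosed (N : Set 𝔸))
    (hsm : ∀ r : ℝ, 0 ≤ r → ∀ a ∈ N, r • a ∈ N) (A : 𝔸) (c : ℝ) (hc : 0 ≤ c)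
    (hB : A + c • 1 ∈ N) {α : ℝ} (h0 : 0 < α) (h1 : α ≤ 1) (t : ℝ) (ht : 0 ≤ t) :
    (∑' l : ℕ, (t ^ (α * l) / Real.Gamma (α * l + α)) • A ^ l) ∈ N := by
  set τ := t ^ α with hτ
  have hτ0 : 0 ≤ τ := by positivity
  have hpow : Tendsto (fun m : ℕ => (m : ℝ) ^ α) atTop atTop :=
    (tendsto_rpow_atTop h0).comp tendsto_natCast_atTop_atTop
  have hsmall : ∀ K : ℝ, ∀ᶠ m : ℕ in atTop, τ / (m : ℝ) ^ α * K < 1 := by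
    intro K
    have : Tendsto (fun m : ℕ => τ / (m : ℝ) ^ α * K) atTop (𝓝 (0 * K)) :=
      (hpow.const_div_atTop τ).mul_const K
    rw [zero_mul] at this
    exact this.eventually (gt_mem_nhds one_pos)
  obtain ⟨L, hLr, hL⟩ := ((hsmall ‖A‖).and (eventually_gt_atTop 0)).exists
  have hlim : Tendsto (fun m : ℕ => ∑' l : ℕ, (τ ^ l * (Real.GammaSeq (α * (l + 1)) m)⁻¹) • A ^ l)
      atTop (𝓝 (∑' l : ℕ, (t ^ (α * l) / Real.Gamma (α * l + α)) • A ^ l)) := by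
    refine tendsto_tsum_of_dominated_convergence
      (bound := fun l : ℕ => ((l : ℝ) + 2) ^ (L + 1) * (τ / (L : ℝ) ^ α * ‖A‖) ^ l * (L + 1))
      ((ml_summable _ (by positivity) hLr).mul_right _) (fun l => ?_) ?_
    · have e : α * (l : ℝ) + α = α * (l + 1) := by ring
      rw [Real.rpow_mul ht, Real.rpow_natCast, ← hτ, e, div_eq_mul_inv]
      refine Tendsto.smul_const (Tendsto.const_mul _ (Tendsto.inv₀
        (Real.GammaSeq_tendsto_Gamma _) (Real.Gamma_pos_of_pos (by positivity)).ne')) _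
    · filter_upwards [eventually_ge_atTop L] with m hm l
      have hm0 : 0 < m := by omega
      have hs : 0 ≤ α * ((l : ℝ) + 1) := by positivity
      have hL1 : (1 : ℝ) ≤ (L : ℝ) ^ α :=
        Real.one_le_rpow (by exact_mod_cast hL) h0.le
      have hb : (Real.GammaSeq (α * (l + 1)) m)⁻¹
          ≤ ((l : ℝ) + 2) ^ (L + 1) * ((L : ℝ) ^ α)⁻¹ ^ l * (L + 1) := by
        rw [inv_gammaSeq m hm0]
        have hb1 := mlRf_bound L hL hs m hm
        have hmp : (0 : ℝ) < (m : ℝ) ^ (α * ((l : ℝ) + 1)) := by positivity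
        calc _ ≤ (1 + α * ((l : ℝ) + 1)) ^ (L + 1) * ((m : ℝ) / L) ^ (α * ((l : ℝ) + 1)) * (L + 1)
              * (m : ℝ) ^ (-(α * ((l : ℝ) + 1))) :=
              mul_le_mul_of_nonneg_right hb1 (by positivity)
          _ = (1 + α * ((l : ℝ) + 1)) ^ (L + 1) * ((L : ℝ) ^ (α * ((l : ℝ) + 1)))⁻¹ * (L + 1) := by
              rw [Real.div_rpow (by positivity) (by positivity), Real.rpow_neg (by positivity)]
              field_simp
          _ ≤ _ := by
              have h2 : 1 + α * ((l : ℝ) + 1) ≤ (l : ℝ) + 2 := by nlinarith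
              refine mul_le_mul_of_nonneg_right (mul_le_mul
                (pow_le_pow_left₀ (by positivity) h2 _) ?_ (by positivity) (by positivity))
                (by positivity)
              · rw [Real.rpow_mul (by positivity), inv_pow]
                have : (l : ℝ) + 1 = ((l + 1 : ℕ) : ℝ) := by push_cast; ring
                rw [this, Real.rpow_natCast]
                exact inv_anti₀ (by positivity) (pow_le_pow_right₀ hL1 (by omega))
      have hn : 0 ≤ (Real.GammaSeq (α * (l + 1)) m)⁻¹ := by
        rw [inv_gammaSeq m hm0]
        have := mlRf_nonneg (m + 1) hs
        positivity
      rw [norm_smul, Real.norm_of_nonneg (by positivity)]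
      calc _ ≤ (τ ^ l * (((l : ℝ) + 2) ^ (L + 1) * ((L : ℝ) ^ α)⁻¹ ^ l * (L + 1))) * ‖A‖ ^ l := by
            gcongr
            exact norm_pow_le A l
        _ = _ := by rw [div_eq_mul_inv, mul_pow, mul_pow]; ring
  refine hN.mem_of_tendsto hlim ?_
  filter_upwards [hsmall ‖A‖, hsmall ‖A + c • (1 : 𝔸)‖, eventually_gt_atTop 0] with m hm1 hm2 hm
  have hD := mlD_mem N hN hsm A c hc hB _ (by positivity) hm2 h0 h1 hm1 (m + 1)
  have e : (∑' l : ℕ, (τ ^ l * (Real.GammaSeq (α * (l + 1)) m)⁻¹) • A ^ l)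
      = ((m + 1) * ((m : ℝ) ^ α)⁻¹) • mlD (τ / (m : ℝ) ^ α) α A (m + 1) := by
    rw [mlD, ← (ml_term_summable (m + 1) (by positivity) h0 h1 A hm1).tsum_const_smul]
    refine tsum_congr fun l => ?_
    rw [smul_smul, inv_gammaSeq m hm, Real.rpow_neg (by positivity), Real.rpow_mul (by positivity)]
    have : (l : ℝ) + 1 = ((l + 1 : ℕ) : ℝ) := by push_cast; ring
    congr 1
    rw [this, Real.rpow_natCast, div_pow, pow_succ]
    field_simp
  rw [e]
  exact hsm _ (by positivity) _ hD

end cone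

attribute [local instance] Matrix.linftyOpNormedRing Matrix.linftyOpNormedAlgebra

lemma ml_matrix {n : ℕ} (A : Matrix (Fin n) (Fin n) ℝ)
    (hA : A.IsMetzler) (α : ℝ) (hα0 : 0 < α) (hα1 : α ≤ 1) (t : ℝ) (ht : 0 ≤ t) (i j : Fin n) :
        0 ≤ (∑' ℓ : ℕ, (t ^ (α * ℓ) / Real.Gamma (α * ℓ + α)) • A ^ ℓ) i j := by
  have : Nonempty (Fin n) := ⟨i⟩
  have : NormOneClass (Matrix (Fin n) (Fin n) ℝ) := Matrix.linfty_opNormOneClass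
  let N : Subsemiring (Matrix (Fin n) (Fin n) ℝ) :=
    { carrier := {M | ∀ i j, 0 ≤ M i j}
      mul_mem' := fun {a b} ha hb i j => by
        rw [Matrix.mul_apply]; exact Finset.sum_nonneg fun k _ => mul_nonneg (ha i k) (hb k j)
      one_mem' := fun i j => by
        rw [Matrix.one_apply]; split_ifs <;> norm_num
      add_mem' := fun {a b} ha hb i j => add_nonneg (ha i j) (hb i j)
      zero_mem' := fun i j => le_rfl }
  have hN : IsClosed (N : Set (Matrix (Fin n) (Fin n) ℝ)) := by
    change IsClosed {M : Matrix (Fin n) (Fin n) ℝ | ∀ i j, 0 ≤ M i j}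
    simp only [Set.ofPred_forall]
    exact isClosed_iInter fun i => isClosed_iInter fun j =>
      isClosed_le continuous_const (continuous_id.matrix_elem i j)
  have hB : A + (∑ k, |A k k|) • (1 : Matrix (Fin n) (Fin n) ℝ) ∈ N := by
    intro i j
    rw [Matrix.add_apply, Matrix.smul_apply, Matrix.one_apply]
    split_ifs with h
    · subst h
      have := Finset.single_le_sum (f := fun k => |A k k|) (fun k _ => abs_nonneg _)
        (Finset.mem_univ i)
      have h3 : (∑ k, |A k k|) • (1 : ℝ) = ∑ k, |A k k| := by rw [smul_eq_mul, mul_one]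
      rw [h3]
      have h4 : |A i i| ≤ ∑ k, |A k k| := this
      linarith [neg_abs_le (A i i)]
    · simpa using hA i j h
  exact ml_cone N hN (fun r hr a ha i j => mul_nonneg hr (ha i j)) A _
    (Finset.sum_nonneg fun k _ => abs_nonneg _) hB hα0 hα1 t ht i j

/-- Let `0 < α ≤ 1` and let `A` be a real `n × n` Metzler matrix.  Then for every
`t ≥ 0` the matrix `E_{α,α}(A t^α) = Σ_{ℓ} (t^(αℓ) / Γ(αℓ + α)) • A^ℓ` is entrywise nonnegative;
consequently `Φ_α(t) := t^(α-1) • E_{α,α}(A t^α)` is entrywise nonnegative for every `t > 0`. -/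
theorem mittagLeffler_alpha_alpha_nonneg_of_metzler {n : ℕ} (A : Matrix (Fin n) (Fin n) ℝ)
    (hA : A.IsMetzler) (α : ℝ) (hα0 : 0 < α) (hα1 : α ≤ 1) :
    (∀ t : ℝ, 0 ≤ t → ∀ i j : Fin n,
        0 ≤ (∑' ℓ : ℕ, (t ^ (α * ℓ) / Real.Gamma (α * ℓ + α)) • A ^ ℓ) i j) ∧
      ∀ t : ℝ, 0 < t → ∀ i j : Fin n,
        0 ≤ (t ^ (α - 1) • ∑' ℓ : ℕ, (t ^ (α * ℓ) / Real.Gamma (α * ℓ + α)) • A ^ ℓ) i j := by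
  refine ⟨fun t ht i j => ml_matrix A hA α hα0 hα1 t ht i j, fun t ht i j => ?_⟩
  rw [Matrix.smul_apply]
  exact mul_nonneg (by positivity) (ml_matrix A hA α hα0 hα1 t ht.le i j)
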